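/- Let X be a nonempty, locally connected topological space and let f : X → ℝ be a continuous proper map with f(x) ≥ 0 for all x ∈ X. Then every connected component of X contains a point which is a local minimum of f; consequently, if the set of local minimum points of f is a connected subset of X, then X is connected. -/

import Mathlib

/-- Morse-theoretic principle: for a nonempty, locally connected space `X` and a
continuous proper nonnegative map `f : X → ℝ`, every connected component of `X`
contains a local minimum point of `f`; consequently, if the set of local minimum
points of `f` is a connected subset of `X`, then `X` is connected. -/
theorem every_component_has_local_min_and_connected_of_localMin_connected
    {X : Type*} [TopologicalSpace X] [Nonempty X] [LocallyConnectedSpace X]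
    (f : X → ℝ) (hf : Continuous f)
    (hproper : ∀ K : Set ℝ, IsCompact K → IsCompact (f ⁻¹' K))
    (hnonneg : ∀ x, 0 ≤ f x) :
    (∀ x : X, ∃ y ∈ connectedComponent x, IsLocalMin f y) ∧
      (IsConnected {x : X | IsLocalMin f x} → ConnectedSpace X) := by
  have exists_min : ∀ x : X, ∃ y ∈ connectedComponent x, IsLocalMin f y := by
    intro x
    have hcompact : IsCompact (f ⁻¹' Set.Icc 0 (f x) ∩ connectedComponent x) :=
      (hproper _ isCompact_Icc).inter_right isClosed_connectedComponent
    obtain ⟨y, ⟨hy, hyx⟩, hmin⟩ := hcompact.exists_isMinOn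
      ⟨x, ⟨hnonneg x, le_rfl⟩, mem_connectedComponent⟩ hf.continuousOn
    refine ⟨y, hyx, ?_⟩
    filter_upwards [isOpen_connectedComponent.mem_nhds hyx] with z hz
    rcases le_total (f z) (f x) with hzx | hxz
    · exact hmin ⟨⟨hnonneg z, hzx⟩, hz⟩
    · exact hy.2.trans hxz
  refine ⟨exists_min, fun hconn => connectedSpace_iff_connectedComponent.mpr ?_⟩
  obtain ⟨x, hx⟩ := hconn.nonempty
  refine ⟨x, Set.eq_univ_of_forall fun z => ?_⟩
  obtain ⟨y, hyz, hy⟩ := exists_min z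
  have hyx := hconn.isPreconnected.subset_connectedComponent hx hy
  rw [connectedComponent_eq hyx, ← connectedComponent_eq hyz]
  exact mem_connectedComponent
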